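/- arXiv:1911.11749 — 2 statements merged into one kernel-verified Lean document; each statement's English description precedes it below -/
import Mathlib

section
/- Let A be a Grothendieck abelian category and T a tilting object of D(A) with endomorphism ring Λ = End(T). Suppose that both A and the category Mod Λ of all right Λ-modules have finite global dimension. Then the triangle equivalence D(A) ≃ D(Mod Λ) induced by RHom(T,-) restricts to a triangle equivalence D^b(A) ≃ D^b(Mod Λ). -/
universe t w w₂ v u v' u'

open CategoryTheory Category Limits Pretriangulated Opposite

section Defs

variable (C : Type u) [Category.{v} C]

/-- The global dimension of an abelian category is at most `d` if
`Ext^i(X, Y) = 0` for all `i > d`, where Ext-groups are interpreted as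
morphisms `X ⟶ Y⟦i⟧` in the derived category between the corresponding
objects concentrated in degree `0`. -/
def GlobalDimLE [Abelian C] [HasDerivedCategory.{w} C] (d : ℕ) : Prop :=
  ∀ (X Y : C) (i : ℤ), (d : ℤ) < i →
    Subsingleton ((DerivedCategory.singleFunctor C 0).obj X ⟶
      (((DerivedCategory.singleFunctor C 0).obj Y)⟦i⟧))

variable {C}

/-- An object of the derived category is (cohomologically) bounded if its
cohomology is concentrated in finitely many degrees; these objects form
the bounded derived category `D^b`. -/
def IsBoundedObj [Abelian C] [HasDerivedCategory.{w} C] (X : DerivedCategory C) : Prop :=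
  {i : ℤ | ¬ IsZero ((DerivedCategory.homologyFunctor C i).obj X)}.Finite

/-- An object `X` of a preadditive category is compact if `Hom(X, -)` commutes with
arbitrary (set-indexed) coproducts, i.e. the additive coyoneda functor of `X`
preserves coproducts. -/
def IsCompactObject {D : Type u'} [Category.{v'} D] [Preadditive D] (X : D) : Prop :=
  ∀ ι : Type t, Nonempty (PreservesColimitsOfShape (Discrete ι)
    (preadditiveCoyoneda.obj (op X)))

end Defs

section Closures

variable {D : Type u'} [Category.{v'} D] [HasZeroObject D] [Preadditive D] [HasShift D ℤ]
  [∀ n : ℤ, (shiftFunctor D n).Additive] [Pretriangulated D]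

/-- The thick subcategory generated by a set of objects: the closure under
isomorphisms, shifts, extensions and direct summands. -/
inductive thickClosure (S : Set D) : D → Prop
  | mem (X : D) (_ : X ∈ S) : thickClosure S X
  | iso {X Y : D} (_ : X ≅ Y) (_ : thickClosure S X) : thickClosure S Y
  | shift (X : D) (n : ℤ) (_ : thickClosure S X) : thickClosure S (X⟦n⟧)
  | ext₂ (T : Triangle D) (_ : T ∈ distTriang D) (_ : thickClosure S T.obj₁)
      (_ : thickClosure S T.obj₃) : thickClosure S T.obj₂
  | smd (X Y : D) (s : Y ⟶ X) (r : X ⟶ Y) (_ : s ≫ r = 𝟙 Y) (_ : thickClosure S X) :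
      thickClosure S Y

/-- The localizing subcategory generated by a set of objects: the closure under
isomorphisms, shifts, extensions and arbitrary (set-indexed) coproducts. -/
inductive localizingClosure (S : Set D) : D → Prop
  | mem (X : D) (_ : X ∈ S) : localizingClosure S X
  | iso {X Y : D} (_ : X ≅ Y) (_ : localizingClosure S X) : localizingClosure S Y
  | shift (X : D) (n : ℤ) (_ : localizingClosure S X) : localizingClosure S (X⟦n⟧)
  | ext₂ (T : Triangle D) (_ : T ∈ distTriang D) (_ : localizingClosure S T.obj₁)
      (_ : localizingClosure S T.obj₃) : localizingClosure S T.obj₂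
  | coprod {ι : Type t} (g : ι → D) (hg : HasCoproduct g)
      (_ : ∀ i, localizingClosure S (g i)) : localizingClosure S (@sigmaObj _ _ _ g hg)

end Closures

section Tilting

variable {C : Type u} [Category.{v} C] [Abelian C] [HasDerivedCategory.{w} C]

/-- A tilting object of the bounded derived category `D^b(C)`: a cohomologically
bounded object `T` with `Hom(T, Σ^i T) = 0` for `i ≠ 0` such that `D^b(C)`
(the subcategory of bounded objects) equals the thick subcategory generated by `T`. -/
def IsBoundedTilting (T : DerivedCategory C) : Prop :=
  IsBoundedObj T ∧ (∀ i : ℤ, i ≠ 0 → Subsingleton (T ⟶ T⟦i⟧)) ∧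
    ∀ X : DerivedCategory C, IsBoundedObj X → thickClosure {T} X

/-- A tilting object of the unbounded derived category `D(C)`: a compact object `T`
with `Hom(T, Σ^i T) = 0` for `i ≠ 0` such that `D(C)` equals the localizing
subcategory generated by `T`. -/
def IsTilting (T : DerivedCategory C) : Prop :=
  IsCompactObject.{t} T ∧ (∀ i : ℤ, i ≠ 0 → Subsingleton (T ⟶ T⟦i⟧)) ∧
    ∀ X : DerivedCategory C, localizingClosure.{t} {T} X

end Tilting



namespace TiltAux

section Coprod
variable {C : Type u} [Category.{v} C] [Abelian C] {J : Type u'}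
  (K : J → CochainComplex C ℤ)

/-- family as complex of functors -/
noncomputable def famCx : CochainComplex (Discrete J ⥤ C) ℤ where
  X n := Discrete.functor (fun j => (K j).X n)
  d n m := Discrete.natTrans (fun j => (K j.as).d n m)
  shape n m h := by
    ext ⟨j⟩
    exact (K j).shape n m h
  d_comp_d' n m p _ _ := by
    ext ⟨j⟩
    exact (K j).d_comp_d n m p

variable {K} in
noncomputable def famMap {L : J → CochainComplex C ℤ} (f : ∀ j, K j ⟶ L j) :
    famCx K ⟶ famCx L where
  f n := Discrete.natTrans (fun j => (f j.as).f n)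
  comm' n m _ := by
    ext ⟨j⟩
    exact (f j).comm n m

variable {K} in
lemma quasiIso_famMap {L : J → CochainComplex C ℤ} (f : ∀ j, K j ⟶ L j)
    (hf : ∀ j, QuasiIso (f j)) : QuasiIso (famMap f) := by
  rw [HomologicalComplex.quasiIso_iff_evaluation]
  rintro ⟨j⟩
  exact hf j

variable [HasColimitsOfShape (Discrete J) C]

noncomputable def sumCx : CochainComplex C ℤ :=
  ((colim (J := Discrete J) (C := C)).mapHomologicalComplex _).obj (famCx K)

noncomputable def sumι (j : J) : K j ⟶ sumCx K where
  f n := colimit.ι ((famCx K).X n) ⟨j⟩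
  comm' n m _ := (ι_colimMap ((famCx K).d n m) ⟨j⟩)

variable {K} in
noncomputable def sumDesc {Y : CochainComplex C ℤ} (g : ∀ j, K j ⟶ Y) : sumCx K ⟶ Y where
  f n := colimit.desc ((famCx K).X n) (Cofan.mk _ (fun j => (g j).f n))
  comm' n m _ := by
    apply colimit.hom_ext
    rintro ⟨j⟩
    refine (colimit.ι_desc_assoc _ _ _).trans (Eq.trans ?_ (ι_colimMap_assoc ((famCx K).d n m) ⟨j⟩ _).symm)
    refine ((g j).comm n m).trans ?_
    exact congr_arg (fun φ => (K j).d n m ≫ φ) (colimit.ι_desc (Cofan.mk _ (fun j => (g j).f m)) ⟨j⟩).symm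

variable {K} in
lemma sumι_desc {Y : CochainComplex C ℤ} (g : ∀ j, K j ⟶ Y) (j : J) :
    sumι K j ≫ sumDesc g = g j := by
  ext n
  exact colimit.ι_desc (Cofan.mk _ (fun j => (g j).f n)) ⟨j⟩

variable {K} in
lemma sum_X_ext {n : ℤ} {Y : C} {f g : (sumCx K).X n ⟶ Y}
    (h : ∀ j, (sumι K j).f n ≫ f = (sumι K j).f n ≫ g) : f = g := by
  apply colimit.hom_ext
  rintro ⟨j⟩
  exact h j

variable {K} in
lemma sum_ext {Y : CochainComplex C ℤ} {f g : sumCx K ⟶ Y}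
    (h : ∀ j, sumι K j ≫ f = sumι K j ≫ g) : f = g := by
  ext n
  apply sum_X_ext
  intro j
  exact congr_arg (fun φ => HomologicalComplex.Hom.f φ n) (h j)

variable {K} in
lemma quasiIso_sumMap [HasExactColimitsOfShape (Discrete J) C] {L : J → CochainComplex C ℤ} (f : ∀ j, K j ⟶ L j)
    (hf : ∀ j, QuasiIso (f j)) : QuasiIso (sumDesc (fun j => f j ≫ sumι L j)) := by
  have := quasiIso_famMap f hf
  have h : sumDesc (fun j => f j ≫ sumι L j) =
    ((colim (J := Discrete J) (C := C)).mapHomologicalComplex _).map (famMap f) := by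
    apply sum_ext
    intro j
    rw [sumι_desc]
    ext n
    exact (ι_colimMap ((famMap f).f n) ⟨j⟩).symm
  have := HasExactColimitsOfShape.preservesFiniteLimits (J := Discrete J) (C := C)
  have : (colim (J := Discrete J) (C := C)).PreservesHomology := inferInstance
  rw [h]
  exact HomologicalComplex.quasiIso_map_of_preservesHomology _ _

end Coprod
end TiltAux



namespace TiltAux

section Coprod2
variable {C : Type u} [Category.{v} C] [Abelian C] {J : Type u'}

lemma exists_qis_homotopy [HasDerivedCategory.{w} C] {K L : CochainComplex C ℤ} (f : K ⟶ L)
    (hf : DerivedCategory.Q.map f = 0) :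
    ∃ (Z : CochainComplex C ℤ) (s : Z ⟶ K) (_ : QuasiIso s), Nonempty (Homotopy (s ≫ f) 0) := by
  have h1 : DerivedCategory.Qh.map ((HomotopyCategory.quotient C (ComplexShape.up ℤ)).map f) =
      DerivedCategory.Qh.map ((HomotopyCategory.quotient C (ComplexShape.up ℤ)).map 0) := by
    rw [Functor.map_zero, Functor.map_zero]
    exact hf
  obtain ⟨Z, s, hs, e⟩ := (MorphismProperty.map_eq_iff_precomp DerivedCategory.Qh
    (HomotopyCategory.quasiIso C (ComplexShape.up ℤ)) _ _).1 h1
  obtain ⟨Z, rfl⟩ := HomotopyCategory.quotient_obj_surjective Z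
  obtain ⟨s, rfl⟩ := (HomotopyCategory.quotient _ _).map_surjective s
  rw [HomotopyCategory.quotient_map_mem_quasiIso_iff] at hs
  refine ⟨Z, s, hs, ?_⟩
  rw [← HomotopyCategory.quotient_map_eq_zero_iff, Functor.map_comp, e, Functor.map_zero, comp_zero]

variable [HasColimitsOfShape (Discrete J) C]

noncomputable def sumXDesc {K : J → CochainComplex C ℤ} {n : ℤ} {Y : C}
    (g : ∀ j, (K j).X n ⟶ Y) : (sumCx K).X n ⟶ Y :=
  colimit.desc ((famCx K).X n) (Cofan.mk _ g)

lemma sumι_xDesc {K : J → CochainComplex C ℤ} {n : ℤ} {Y : C}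
    (g : ∀ j, (K j).X n ⟶ Y) (j : J) : (sumι K j).f n ≫ sumXDesc g = g j :=
  colimit.ι_desc (Cofan.mk _ g) ⟨j⟩

noncomputable def sumHomotopy {K : J → CochainComplex C ℤ} {Y : CochainComplex C ℤ}
    (f : sumCx K ⟶ Y) (h : ∀ j, Homotopy (sumι K j ≫ f) 0) : Homotopy f 0 where
  hom n m := sumXDesc (fun j => (h j).hom n m)
  zero n m hnm := by
    apply sum_X_ext
    intro j
    rw [sumι_xDesc, comp_zero]
    exact (h j).zero n m hnm
  comm n := by
    apply sum_X_ext
    intro j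
    have h1 := (h j).comm n
    rw [dNext_eq _ (show (ComplexShape.up ℤ).Rel n (n+1) by simp),
      prevD_eq _ (show (ComplexShape.up ℤ).Rel (n-1) n by simp)] at h1 ⊢
    simp only [HomologicalComplex.zero_f, add_zero, HomologicalComplex.comp_f] at h1 ⊢
    rw [h1, Preadditive.comp_add, ← assoc, (sumι K j).comm, assoc, sumι_xDesc, ← assoc, sumι_xDesc]

variable [HasExactColimitsOfShape (Discrete J) C] [HasDerivedCategory.{w} C]

lemma sum_hom_eq_zero {K : J → CochainComplex C ℤ} {Y : DerivedCategory C}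
    (f : DerivedCategory.Q.obj (sumCx K) ⟶ Y)
    (h : ∀ j, DerivedCategory.Q.map (sumι K j) ≫ f = 0) : f = 0 := by
  let e := DerivedCategory.Q.objObjPreimageIso Y
  rw [← cancel_mono e.inv, zero_comp]
  have h' : ∀ j, DerivedCategory.Q.map (sumι K j) ≫ f ≫ e.inv = 0 := fun j => by
    rw [← assoc, h, zero_comp]
  generalize f ≫ e.inv = f' at h'
  clear h
  obtain ⟨Y', g, s, hs, rfl⟩ := DerivedCategory.left_fac f'
  have h2 : ∀ j, DerivedCategory.Q.map (sumι K j ≫ g) = 0 := fun j => by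
    have := h' j
    rw [← assoc, ← Functor.map_comp] at this
    rw [← cancel_mono (inv (DerivedCategory.Q.map s)), this, zero_comp]
  choose Z t ht hom using fun j => exists_qis_homotopy _ (h2 j)
  have hq := quasiIso_sumMap t ht
  have hz : DerivedCategory.Q.map (sumDesc (fun j => t j ≫ sumι K j) ≫ g) = 0 := by
    rw [DerivedCategory.Q_map_eq_of_homotopy _ (sumHomotopy _ (fun j => Homotopy.trans (Homotopy.ofEq ?_) (hom j).some)),
      Functor.map_zero]
    rw [← assoc, sumι_desc, assoc]
  rw [Functor.map_comp] at hz
  have : DerivedCategory.Q.map g = 0 := by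
    rw [← cancel_epi (DerivedCategory.Q.map (sumDesc (fun j => t j ≫ sumι K j))), hz, comp_zero]
  rw [this, zero_comp]

lemma exists_sum_desc {K : J → CochainComplex C ℤ} {Y : DerivedCategory C}
    (g : ∀ j, DerivedCategory.Q.obj (K j) ⟶ Y) :
    ∃ f : DerivedCategory.Q.obj (sumCx K) ⟶ Y,
      ∀ j, DerivedCategory.Q.map (sumι K j) ≫ f = g j := by
  let e := DerivedCategory.Q.objObjPreimageIso Y
  choose Z s hs k hk using fun j => DerivedCategory.right_fac (g j ≫ e.inv)
  have hs' : ∀ j, QuasiIso (s j) := fun j => (DerivedCategory.isIso_Q_map_iff_quasiIso _ _).1 (hs j)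
  have hq := quasiIso_sumMap s hs'
  refine ⟨inv (DerivedCategory.Q.map (sumDesc (fun j => s j ≫ sumι K j))) ≫
    DerivedCategory.Q.map (sumDesc k) ≫ e.hom, fun j => ?_⟩
  have : DerivedCategory.Q.map (sumι K j) ≫ inv (DerivedCategory.Q.map (sumDesc (fun j => s j ≫ sumι K j))) 
    = inv (DerivedCategory.Q.map (s j)) ≫ DerivedCategory.Q.map (sumι Z j) := by
    rw [IsIso.comp_inv_eq, assoc, IsIso.eq_inv_comp, ← Functor.map_comp, ← Functor.map_comp,
      sumι_desc]
  rw [← assoc, this, assoc, ← assoc (DerivedCategory.Q.map (sumι Z j)), ← Functor.map_comp, sumι_desc,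
    ← assoc, ← hk, assoc, e.inv_hom_id, comp_id]

end Coprod2
end TiltAux



namespace TiltAux

section Compact
variable {C : Type u} [Category.{v} C] [Abelian C] {J : Type u'}
variable [HasDerivedCategory.{w} C]

lemma compact_subgroup [HasColimitsOfShape (Discrete J) C]
    [HasExactColimitsOfShape (Discrete J) C]
    (T : DerivedCategory C) (hT : IsCompactObject.{t} T) {I : Type t} (e : I ≃ J)
    (K : J → CochainComplex C ℤ) (H : AddSubgroup (T ⟶ DerivedCategory.Q.obj (sumCx K)))
    (hH : ∀ j (φ : T ⟶ DerivedCategory.Q.obj (K j)), φ ≫ DerivedCategory.Q.map (sumι K j) ∈ H)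
    (x : T ⟶ DerivedCategory.Q.obj (sumCx K)) : x ∈ H := by
  obtain ⟨hp⟩ := hT I
  let c : Cofan (fun i : I => DerivedCategory.Q.obj (K (e i))) :=
    Cofan.mk (DerivedCategory.Q.obj (sumCx K)) (fun i => DerivedCategory.Q.map (sumι K (e i)))
  have hc : IsColimit c := by
    refine Cofan.IsColimit.mk c
      (fun s => (exists_sum_desc (fun j => eqToHom (by simp) ≫ s.inj (e.symm j))).choose) ?_ ?_
    · intro s i
      refine ((exists_sum_desc (fun j => eqToHom (by simp) ≫ s.inj (e.symm j))).choose_spec (e i)).trans ?_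
      have : ∀ i' (h : i' = i), eqToHom (by rw [h]) ≫ s.inj i' = s.inj i := by
        rintro _ rfl
        simp
      exact this _ (by simp)
    · intro s m hm
      rw [← sub_eq_zero]
      apply sum_hom_eq_zero
      intro j
      rw [Preadditive.comp_sub, sub_eq_zero]
      refine Eq.trans ?_ ((exists_sum_desc (fun j => eqToHom (by simp) ≫ s.inj (e.symm j))).choose_spec j).symm
      obtain ⟨i, rfl⟩ := e.surjective j
      have : ∀ i' (h : i' = i), eqToHom (by rw [h]) ≫ s.inj i' = s.inj i := by
        rintro _ rfl
        simp
      rw [this _ (by simp)]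
      exact hm i
  have hc' := isColimitOfPreserves (preadditiveCoyoneda.obj (op T)) hc
  let q : (preadditiveCoyoneda.obj (op T)).obj (DerivedCategory.Q.obj (sumCx K)) ⟶
      AddCommGrpCat.of ((T ⟶ DerivedCategory.Q.obj (sumCx K)) ⧸ H) :=
    AddCommGrpCat.ofHom (QuotientAddGroup.mk' H)
  have hq : q = 0 := by
    apply hc'.hom_ext
    rintro ⟨i⟩
    ext φ
    exact (QuotientAddGroup.eq_zero_iff _).2 (hH (e i) φ)
  have := ConcreteCategory.congr_hom hq x
  exact (QuotientAddGroup.eq_zero_iff _).1 this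

/-- degrees of injective objects mapped to nontrivially -/
def suppSet (X : DerivedCategory C) : Set ℤ :=
  {i | ∃ (E : C) (_ : Injective E) (f : X ⟶ (DerivedCategory.singleFunctor C i).obj E), f ≠ 0}

lemma exists_chain_of_injective (K : CochainComplex C ℤ) (i : ℤ) (E : C) [Injective E]
    (f : DerivedCategory.Q.obj K ⟶ (DerivedCategory.singleFunctor C i).obj E) :
    ∃ φ : K ⟶ (HomologicalComplex.single C (ComplexShape.up ℤ) i).obj E,
      DerivedCategory.Q.map φ = f := by
  have : ∀ n, Injective (((HomologicalComplex.single C (ComplexShape.up ℤ) i).obj E).X n) := by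
    intro n
    by_cases h : n = i
    · subst h
      exact Injective.of_iso (HomologicalComplex.singleObjXSelf _ _ _).symm inferInstance
    · exact (HomologicalComplex.isZero_single_obj_X _ _ _ _ h).injective
  have := CochainComplex.isKInjective_of_injective
    ((HomologicalComplex.single C (ComplexShape.up ℤ) i).obj E) i
  obtain ⟨g, hg⟩ := (CochainComplex.IsKInjective.Qh_map_bijective
    ((HomotopyCategory.quotient _ _).obj K)
    ((HomologicalComplex.single C (ComplexShape.up ℤ) i).obj E)).surjective f
  obtain ⟨g, rfl⟩ := (HomotopyCategory.quotient _ _).map_surjective g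
  exact ⟨g, hg⟩

end Compact
end TiltAux



namespace TiltAux

section Supp
variable {C : Type u} [Category.{v} C] [Abelian C]

noncomputable abbrev sg (i : ℤ) (E : C) : CochainComplex C ℤ :=
  (HomologicalComplex.single C (ComplexShape.up ℤ) i).obj E

section
set_option linter.unusedSectionVars false
variable [HasColimitsOfShape (Discrete (ULift.{v} ℤ)) C]

noncomputable def toSum (K : CochainComplex C ℤ) (E : ℤ → C) (φ : ∀ i, K ⟶ sg i (E i)) :
    K ⟶ sumCx (fun j : ULift.{v} ℤ => sg j.down (E j.down)) where
  f n := (φ n).f n ≫ (sumι (fun j : ULift.{v} ℤ => sg j.down (E j.down)) ⟨n⟩).f n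
  comm' n m _ := by
    rw [assoc, ← assoc (K.d n m), ← (φ m).comm, HomologicalComplex.single_obj_d, comp_zero,
      zero_comp, (sumι (fun j : ULift.{v} ℤ => sg j.down (E j.down)) ⟨n⟩).comm,
      HomologicalComplex.single_obj_d, zero_comp, comp_zero]

open Classical in
noncomputable def sumProj {J : Type u'} [HasColimitsOfShape (Discrete J) C]
    (K : J → CochainComplex C ℤ) (j : J) :
    sumCx K ⟶ K j := sumDesc (fun k => if h : k = j then eqToHom (by rw [h]) else 0)

lemma sumι_proj_self {J : Type u'} [HasColimitsOfShape (Discrete J) C]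
    (K : J → CochainComplex C ℤ) (j : J) : sumι K j ≫ sumProj K j = 𝟙 _ := by
  rw [sumProj, sumι_desc]
  simp

lemma sumι_proj_ne {J : Type u'} [HasColimitsOfShape (Discrete J) C]
    (K : J → CochainComplex C ℤ) (i j : J) (h : i ≠ j) : sumι K i ≫ sumProj K j = 0 := by
  rw [sumProj, sumι_desc]
  simp [h]

lemma toSum_proj (K : CochainComplex C ℤ) (E : ℤ → C) (φ : ∀ i, K ⟶ sg i (E i)) (n : ℤ) :
    toSum K E φ ≫ sumProj _ ⟨n⟩ = φ n := by
  ext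
  rw [HomologicalComplex.comp_f]
  dsimp only [toSum]
  rw [assoc, ← HomologicalComplex.comp_f, sumι_proj_self, HomologicalComplex.id_f, comp_id]

variable [HasExactColimitsOfShape (Discrete (ULift.{v} ℤ)) C]
variable [HasDerivedCategory.{w} C]

lemma suppSet_finite (T : DerivedCategory C) (hT : IsCompactObject.{t} T) :
    (suppSet T).Finite := by
  classical
  have h1 : ∀ i : ℤ, ∃ (E : C) (_ : Injective E)
      (f : T ⟶ (DerivedCategory.singleFunctor C i).obj E), i ∈ suppSet T → f ≠ 0 := by
    intro i
    by_cases h : i ∈ suppSet T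
    · obtain ⟨E, hE, f, hf⟩ := h
      exact ⟨E, hE, f, fun _ => hf⟩
    · obtain ⟨Z, hZ⟩ := HasZeroObject.zero (C := C)
      exact ⟨Z, hZ.injective, 0, fun h' => (h h').elim⟩
  choose E hE f hf using h1
  let e := DerivedCategory.Q.objObjPreimageIso T
  choose φ hφ using fun i => exists_chain_of_injective (DerivedCategory.Q.objPreimage T) i (E i)
    (e.hom ≫ f i)
  let K := (fun j : ULift.{v} ℤ => sg j.down (E j.down))
  let H : AddSubgroup (T ⟶ DerivedCategory.Q.obj (sumCx K)) :=
    { carrier := {g | {j | g ≫ DerivedCategory.Q.map (sumProj K j) ≠ 0}.Finite}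
      zero_mem' := by simp
      add_mem' := by
        intro a b ha hb
        refine (Set.Finite.union ha hb).subset ?_
        intro j hj
        by_contra hcon
        have hcon' := not_or.1 hcon
        have h1 := not_not.1 hcon'.1
        have h2 := not_not.1 hcon'.2
        apply hj
        rw [Preadditive.add_comp, h1, h2, add_zero]
      neg_mem' := by
        intro a ha
        simpa using ha }
  have hx := compact_subgroup T hT (Equiv.ulift.{t}.trans Equiv.ulift.{v}.symm) K H (by
    intro j ψ
    refine (Set.finite_singleton j).subset ?_
    intro k hk
    by_contra hne
    apply hk
    rw [assoc, ← Functor.map_comp, sumι_proj_ne _ _ _ (fun h => hne h.symm), Functor.map_zero, comp_zero])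
    (e.inv ≫ DerivedCategory.Q.map (toSum _ E φ))
  have hx' : Set.Finite {j | (e.inv ≫ DerivedCategory.Q.map (toSum _ E φ)) ≫
    DerivedCategory.Q.map (sumProj K j) ≠ 0} := hx
  refine (hx'.image (fun j => j.down)).subset ?_
  intro i hi
  refine ⟨⟨i⟩, ?_, rfl⟩
  change ¬ (e.inv ≫ DerivedCategory.Q.map (toSum _ E φ)) ≫ DerivedCategory.Q.map (sumProj K ⟨i⟩) = 0
  rw [assoc, ← Functor.map_comp, toSum_proj, hφ]
  intro h0
  exact hf i hi ((e.inv_hom_id_assoc (f i)).symm.trans h0)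

end

end Supp
end TiltAux



namespace TiltAux

section Detect
variable {C : Type u} [Category.{v} C] [Abelian C] [HasDerivedCategory.{w} C]

lemma homologyMap_eq_zero_of_Q_map {K L : CochainComplex C ℤ} (φ : K ⟶ L)
    (h : DerivedCategory.Q.map φ = 0) (i : ℤ) : HomologicalComplex.homologyMap φ i = 0 := by
  have := DerivedCategory.homologyFunctorFactors_hom_naturality φ i
  rw [h, Functor.map_zero, zero_comp] at this
  exact (cancel_epi ((DerivedCategory.homologyFunctorFactors C i).hom.app K)).1
    (this.symm.trans comp_zero.symm)

lemma exists_to_single {K : CochainComplex C ℤ} {i : ℤ} {B : C} (b : K.opcycles i ⟶ B)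
    (hb : K.homologyι i ≫ b ≠ 0) :
    ∃ φ : K ⟶ sg i B, DerivedCategory.Q.map φ ≠ 0 := by
  let φ : K ⟶ sg i B := HomologicalComplex.mkHomToSingle (K.pOpcycles i ≫ b)
    (fun j _ => by rw [← assoc, K.d_pOpcycles, zero_comp])
  refine ⟨φ, fun h => hb ?_⟩
  have h0 := homologyMap_eq_zero_of_Q_map φ h i
  have h1 := HomologicalComplex.homologyι_naturality φ i
  rw [h0, zero_comp] at h1
  have h2 := HomologicalComplex.p_opcyclesMap φ i
  have h3 : φ.f i = (K.pOpcycles i ≫ b) ≫ _ := HomologicalComplex.mkHomToSingle_f _ _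
  rw [h3, assoc, assoc, cancel_epi] at h2
  have : IsIso ((sg i B).pOpcycles i) := (sg i B).isIso_pOpcycles (i-1) i (by simp) rfl
  rw [h2, ← assoc] at h1
  exact ((cancel_mono _).1 (h1.symm.trans zero_comp.symm))

lemma exists_from_single {K : CochainComplex C ℤ} {i : ℤ} {B : C} (b : B ⟶ K.cycles i)
    (hb : b ≫ K.homologyπ i ≠ 0) :
    ∃ φ : sg i B ⟶ K, DerivedCategory.Q.map φ ≠ 0 := by
  let φ : sg i B ⟶ K := HomologicalComplex.mkHomFromSingle (b ≫ K.iCycles i)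
    (fun j _ => by rw [assoc, K.iCycles_d, comp_zero])
  refine ⟨φ, fun h => hb ?_⟩
  have h0 := homologyMap_eq_zero_of_Q_map φ h i
  have h1 := HomologicalComplex.homologyπ_naturality φ i
  rw [h0, comp_zero] at h1
  have h2 := HomologicalComplex.cyclesMap_i φ i
  have h3 : φ.f i = _ ≫ (b ≫ K.iCycles i) := HomologicalComplex.mkHomFromSingle_f _ _
  rw [h3, ← assoc, ← assoc, cancel_mono] at h2
  have : IsIso ((sg i B).iCycles i) := (sg i B).isIso_iCycles i (i+1) (by simp) rfl
  rw [h2, assoc] at h1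
  exact ((cancel_epi _).1 (h1.symm.trans comp_zero.symm))

lemma mem_suppSet_of_homology [EnoughInjectives C] (X : DerivedCategory C) (i : ℤ)
    (h : ¬ IsZero ((DerivedCategory.homologyFunctor C i).obj X)) : i ∈ suppSet X := by
  let e := DerivedCategory.Q.objObjPreimageIso X
  let K := DerivedCategory.Q.objPreimage X
  obtain ⟨φ, hφ⟩ := exists_to_single (K := K) (i := i) (Injective.ι (K.opcycles i)) (by
    intro h0
    apply h
    have h1 : K.homologyι i = 0 := by rw [← cancel_mono (Injective.ι (K.opcycles i)), h0, zero_comp]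
    have h2 : IsZero (K.homology i) := by
      rw [IsZero.iff_id_eq_zero, ← cancel_mono (K.homologyι i), h1, comp_zero, comp_zero]
    exact h2.of_iso ((DerivedCategory.homologyFunctor C i).mapIso e.symm ≪≫
      (DerivedCategory.homologyFunctorFactors C i).app K))
  refine ⟨Injective.under (K.opcycles i), inferInstance, e.inv ≫ DerivedCategory.Q.map φ, fun h0 => hφ ?_⟩
  exact (cancel_epi e.inv).1 (h0.trans comp_zero.symm)

end Detect

lemma exists_from_ring_of_homology {R : Type w₂} [Ring R] [HasDerivedCategory.{w} (ModuleCat.{w₂} R)]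
    (X : DerivedCategory (ModuleCat.{w₂} R)) (i : ℤ)
    (h : ¬ IsZero ((DerivedCategory.homologyFunctor _ i).obj X)) :
    ∃ f : (DerivedCategory.singleFunctor (ModuleCat.{w₂} R) i).obj (ModuleCat.of R R) ⟶ X, f ≠ 0 := by
  let e := DerivedCategory.Q.objObjPreimageIso X
  let K := DerivedCategory.Q.objPreimage X
  by_contra hcon
  push Not at hcon
  apply h
  have h1 : K.homologyπ i = 0 := by
    ext x
    by_contra hx
    obtain ⟨φ, hφ⟩ := exists_from_single (K := K) (i := i)
      (ModuleCat.ofHom (LinearMap.toSpanSingleton R _ x)) (B := ModuleCat.of R R) (by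
      intro h0
      apply hx
      have := ConcreteCategory.congr_hom h0 (1 : R)
      refine Eq.trans ?_ this
      change K.homologyπ i x = K.homologyπ i ((1 : R) • x)
      rw [one_smul])
    exact hφ ((cancel_mono e.hom).1 ((hcon _).trans zero_comp.symm))
  have h2 : IsZero (K.homology i) := by
    rw [IsZero.iff_id_eq_zero, ← cancel_epi (K.homologyπ i), h1, zero_comp, zero_comp]
  exact h2.of_iso ((DerivedCategory.homologyFunctor _ i).mapIso e.symm ≪≫
      (DerivedCategory.homologyFunctorFactors _ i).app K)

end TiltAux



namespace TiltAux

section Devissage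
variable {C : Type u} [Category.{v} C] [Abelian C] [HasDerivedCategory.{w} C]

structure TriClosed (P : DerivedCategory C → Prop) : Prop where
  iso : ∀ {X Y : DerivedCategory C}, (X ≅ Y) → P X → P Y
  shift : ∀ (X : DerivedCategory C) (n : ℤ), P X → P (X⟦n⟧)
  ext₂ : ∀ (T : Triangle (DerivedCategory C)), T ∈ distTriang (DerivedCategory C) →
    P T.obj₁ → P T.obj₃ → P T.obj₂

noncomputable def singleShiftIso (n m k : ℤ) (h : n + m = k) (M : C) :
    ((DerivedCategory.singleFunctor C k).obj M)⟦n⟧ ≅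
      (DerivedCategory.singleFunctor C m).obj M :=
  ((DerivedCategory.singleFunctors C).shiftIso n m k h).app M

variable {P : DerivedCategory C → Prop} (hP : TriClosed P)
include hP

lemma TriClosed.ext₁ (T : Triangle (DerivedCategory C)) (hT : T ∈ distTriang (DerivedCategory C))
    (h₂ : P T.obj₂) (h₃ : P T.obj₃) : P T.obj₁ :=
  hP.ext₂ _ (inv_rot_of_distTriang _ hT) (hP.shift _ _ h₃) h₂

lemma TriClosed.ext₃ (T : Triangle (DerivedCategory C)) (hT : T ∈ distTriang (DerivedCategory C))
    (h₁ : P T.obj₁) (h₂ : P T.obj₂) : P T.obj₃ :=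
  hP.ext₂ _ (rot_of_distTriang _ hT) h₂ (hP.shift _ _ h₁)

lemma TriClosed.single (h0 : ∀ M : C, P ((DerivedCategory.singleFunctor C 0).obj M)) (n : ℤ) (M : C) :
    P ((DerivedCategory.singleFunctor C n).obj M) :=
  hP.iso (singleShiftIso (-n) n 0 (by simp) M) (hP.shift _ _ (h0 M))

lemma TriClosed.of_isZero (h0 : ∀ M : C, P ((DerivedCategory.singleFunctor C 0).obj M))
    (X : DerivedCategory C) (hX : IsZero X) : P X := by
  obtain ⟨Z, hZ⟩ := HasZeroObject.zero (C := C)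
  exact hP.iso (((DerivedCategory.singleFunctor C 0).map_isZero hZ).iso hX) (h0 Z)

lemma TriClosed.of_isGE_isLE (h0 : ∀ M : C, P ((DerivedCategory.singleFunctor C 0).obj M))
    (n : ℕ) : ∀ (a : ℤ) (X : DerivedCategory C), X.IsGE a → X.IsLE (a + n) → P X := by
  induction n with
  | zero =>
    intro a X h1 h2
    simp only [Nat.cast_zero, add_zero] at h2
    obtain ⟨M, ⟨e⟩⟩ := DerivedCategory.exists_iso_singleFunctor_obj_of_isGE_of_isLE X a
    exact hP.iso e.symm (hP.single h0 a M)
  | succ n ih =>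
    intro a X h1 h2
    let t := DerivedCategory.TStructure.t (C := C)
    refine hP.ext₂ _ (t.triangleLEGE_distinguished a (a+1) rfl X) ?_ ?_
    · change P ((t.truncLE a).obj X)
      have i1 : t.IsGE ((t.truncLE a).obj X) a := inferInstance
      have i2 : t.IsLE ((t.truncLE a).obj X) a := inferInstance
      obtain ⟨M, ⟨e⟩⟩ := DerivedCategory.exists_iso_singleFunctor_obj_of_isGE_of_isLE
        ((t.truncLE a).obj X) a
      exact hP.iso e.symm (hP.single h0 a M)
    · change P ((t.truncGE (a+1)).obj X)
      refine ih (a+1) _ ?_ ?_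
      · change t.IsGE _ _
        infer_instance
      · have : a + 1 + (n : ℤ) = a + ((n + 1 : ℕ) : ℤ) := by push_cast; ring
        rw [this]
        change t.IsLE _ _
        infer_instance

lemma TriClosed.of_bounded (h0 : ∀ M : C, P ((DerivedCategory.singleFunctor C 0).obj M))
    (X : DerivedCategory C) (hX : IsBoundedObj X) : P X := by
  obtain ⟨b, hb⟩ := hX.bddAbove
  obtain ⟨a, ha⟩ := hX.bddBelow
  refine hP.of_isGE_isLE h0 (b - a).toNat a X ?_ ?_
  · rw [DerivedCategory.isGE_iff]
    intro i hi
    by_contra h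
    have := ha h
    lia
  · rw [DerivedCategory.isLE_iff]
    intro i hi
    by_contra h
    have := ha h
    have := hb h
    lia

lemma TriClosed.of_injectives [EnoughInjectives C] (d : ℕ) (hd : GlobalDimLE.{w} C d)
    (h0 : ∀ M : C, Injective M → P ((DerivedCategory.singleFunctor C 0).obj M)) (M : C) :
    P ((DerivedCategory.singleFunctor C 0).obj M) := by
  have := HasExt.standard C
  have h1 : HasInjectiveDimensionLT M (d + 1) := by
    refine HasInjectiveDimensionLT.mk (fun i hi Y e => ?_)
    have := hd Y M i (by lia)
    apply Abelian.Ext.homEquiv.injective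
    exact Subsingleton.elim (α := ((DerivedCategory.singleFunctor C 0).obj Y ⟶
      (((DerivedCategory.singleFunctor C 0).obj M)⟦(i : ℤ)⟧))) _ _
  clear hd
  induction d generalizing M with
  | zero => exact h0 M (injective_iff_hasInjectiveDimensionLT_one.2 h1)
  | succ d ih =>
    let S := ShortComplex.mk (Injective.ι M) (cokernel.π (Injective.ι M)) (by simp)
    have hS : S.ShortExact := { exact := ShortComplex.exact_cokernel _ }
    have h3 : HasInjectiveDimensionLT S.X₃ (d + 1) :=
      (hS.hasInjectiveDimensionLT_X₃_iff d (Injective.injective_under M)).2 h1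
    exact hP.ext₁ _ hS.singleTriangle_distinguished
      (h0 _ (Injective.injective_under M)) (ih S.X₃ h3)

lemma TriClosed.of_projectives [EnoughProjectives C] (d : ℕ) (hd : GlobalDimLE.{w} C d)
    (h0 : ∀ M : C, Projective M → P ((DerivedCategory.singleFunctor C 0).obj M)) (M : C) :
    P ((DerivedCategory.singleFunctor C 0).obj M) := by
  have := HasExt.standard C
  have h1 : HasProjectiveDimensionLT M (d + 1) := by
    refine HasProjectiveDimensionLT.mk (fun i hi Y e => ?_)
    have := hd M Y i (by lia)
    apply Abelian.Ext.homEquiv.injective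
    exact Subsingleton.elim (α := ((DerivedCategory.singleFunctor C 0).obj M ⟶
      (((DerivedCategory.singleFunctor C 0).obj Y)⟦(i : ℤ)⟧))) _ _
  clear hd
  induction d generalizing M with
  | zero => exact h0 M (projective_iff_hasProjectiveDimensionLT_one.2 h1)
  | succ d ih =>
    let S := ShortComplex.mk (kernel.ι (Projective.π M)) (Projective.π M) (by simp)
    have hS : S.ShortExact := { exact := ShortComplex.exact_kernel _ }
    have h3 : HasProjectiveDimensionLT S.X₁ (d + 1) :=
      (hS.hasProjectiveDimensionLT_X₃_iff d (Projective.projective_over M)).1 h1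
    exact hP.ext₃ _ hS.singleTriangle_distinguished
      (ih S.X₁ h3) (h0 _ (Projective.projective_over M))

end Devissage
end TiltAux



namespace TiltAux

section Retract

lemma projective_retract {R : Type w₂} [Ring R] (M : ModuleCat.{w₂} R) (hM : Projective M) :
    ∃ (s : sg 0 M ⟶ sumCx (fun _ : M => sg 0 (ModuleCat.of R R)))
      (r : sumCx (fun _ : M => sg 0 (ModuleCat.of R R)) ⟶ sg 0 M), s ≫ r = 𝟙 _ := by
  let K : M → CochainComplex (ModuleCat.{w₂} R) ℤ := fun _ => sg 0 (ModuleCat.of R R)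
  have h1 : Module.Projective R M := (IsProjective.iff_projective M).2 hM
  obtain ⟨s, hs⟩ := Module.projective_def'.1 h1
  let inc : ∀ _ : M, ModuleCat.of R R ⟶ (sumCx K).X 0 := fun m =>
    (HomologicalComplex.singleObjXSelf (ComplexShape.up ℤ) 0 (ModuleCat.of R R)).inv ≫ (sumι K m).f 0
  let ψ : (M →₀ R) →ₗ[R] (sumCx K).X 0 := Finsupp.lsum ℕ (fun m => (inc m).hom)
  let ψ' : ModuleCat.of R (M →₀ R) ⟶ (sumCx K).X 0 := ModuleCat.ofHom ψ
  have hd : ∀ j, (sumCx K).d 0 j = 0 := by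
    intro j
    apply sum_X_ext
    intro m
    rw [(sumι K m).comm, comp_zero]
    rw [HomologicalComplex.single_obj_d, zero_comp]
  let σ : sg 0 M ⟶ sumCx K := HomologicalComplex.mkHomFromSingle (ModuleCat.ofHom s ≫ ψ')
    (fun j _ => by rw [hd, comp_zero])
  let g : ∀ m : M, ModuleCat.of R R ⟶ M := fun m => ModuleCat.ofHom (LinearMap.toSpanSingleton R M m)
  let ρ : sumCx K ⟶ sg 0 M := sumDesc
    (fun m => (HomologicalComplex.single _ (ComplexShape.up ℤ) 0).map (g m))
  refine ⟨σ, ρ, ?_⟩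
  apply HomologicalComplex.from_single_hom_ext
  have e1 : ∀ m, inc m ≫ ρ.f 0 ≫
      (HomologicalComplex.singleObjXSelf (ComplexShape.up ℤ) 0 M).hom = g m := by
    intro m
    have := congrArg (fun f => HomologicalComplex.Hom.f f 0) (sumι_desc (K := K) (fun m =>
      (HomologicalComplex.single _ (ComplexShape.up ℤ) 0).map (g m)) m)
    have h2 : (sumι K m).f 0 ≫ ρ.f 0 =
      ((HomologicalComplex.single _ (ComplexShape.up ℤ) 0).map (g m)).f 0 := this
    simp only [inc, assoc, reassoc_of% h2, HomologicalComplex.single_map_f_self]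
    simp
  have e2 : ψ' ≫ ρ.f 0 ≫ (HomologicalComplex.singleObjXSelf (ComplexShape.up ℤ) 0 M).hom =
      ModuleCat.ofHom (Finsupp.linearCombination R id) := by
    apply ModuleCat.hom_ext
    apply Finsupp.lhom_ext
    intro m a
    have := congrArg (fun f => f.hom a) (e1 m)
    have h3 : ψ (Finsupp.single m a) = (inc m).hom a := by simp [ψ]
    rw [show (ModuleCat.Hom.hom (ψ' ≫ ρ.f 0 ≫
      (HomologicalComplex.singleObjXSelf (ComplexShape.up ℤ) 0 M).hom)) (Finsupp.single m a)
      = (ρ.f 0 ≫ (HomologicalComplex.singleObjXSelf (ComplexShape.up ℤ) 0 M).hom).hom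
        (ψ (Finsupp.single m a)) from rfl, h3]
    refine Eq.trans this ?_
    simp [g]
  have e3 : ModuleCat.ofHom s ≫ ModuleCat.ofHom (Finsupp.linearCombination R id) = 𝟙 M := by
    rw [← ModuleCat.ofHom_comp, hs]; rfl
  rw [← cancel_mono (HomologicalComplex.singleObjXSelf (ComplexShape.up ℤ) 0 M).hom,
    HomologicalComplex.comp_f, HomologicalComplex.mkHomFromSingle_f, assoc, assoc, assoc, e2, e3,
    comp_id, HomologicalComplex.id_f, id_comp]

end Retract

section Dir1
variable {C : Type u} [Category.{v} C] [Abelian C] [HasDerivedCategory.{w} C]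

def homSet (T X : DerivedCategory C) : Set ℤ := {i | ∃ f : T⟦i⟧ ⟶ X, f ≠ 0}

lemma homSet_triClosed (T : DerivedCategory C) :
    TriClosed (fun X => (homSet T X).Finite) where
  iso := by
    intro X Y e h
    refine h.subset ?_
    rintro i ⟨f, hf⟩
    refine ⟨f ≫ e.inv, fun h0 => hf ?_⟩
    rw [← cancel_mono e.inv, h0, zero_comp]
  shift := by
    intro X n h
    refine (h.image (fun i => i + n)).subset ?_
    rintro i ⟨f, hf⟩
    refine ⟨i + (-n), ?_, by simp⟩
    let a : T⟦i + (-n)⟧ ≅ (T⟦i⟧)⟦-n⟧ := (shiftFunctorAdd (DerivedCategory C) i (-n)).app T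
    let b : (X⟦n⟧)⟦-n⟧ ≅ X := (shiftFunctorCompIsoId (DerivedCategory C) n (-n) (by simp)).app X
    refine ⟨a.hom ≫ f⟦-n⟧' ≫ b.hom, fun h0 => hf ?_⟩
    apply (shiftFunctor (DerivedCategory C) (-n)).map_injective
    rw [← cancel_mono b.hom, ← cancel_epi a.hom]
    rw [h0]; simp
  ext₂ := by
    intro Δ hΔ h1 h3
    refine (h1.union h3).subset ?_
    rintro i ⟨f, hf⟩
    by_cases h : f ≫ Δ.mor₂ = 0
    · obtain ⟨g, hg⟩ := Triangle.coyoneda_exact₂ Δ hΔ f h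
      refine Or.inl ⟨g, ?_⟩
      rintro rfl
      exact hf (hg.trans zero_comp)
    · exact Or.inr ⟨_, h⟩

lemma homSet_injective (T : DerivedCategory C) (hT : (suppSet T).Finite) (E : C) (hE : Injective E) :
    (homSet T ((DerivedCategory.singleFunctor C 0).obj E)).Finite := by
  refine hT.subset ?_
  rintro i ⟨f, hf⟩
  refine ⟨E, hE, ?_⟩
  let a : (T⟦i⟧)⟦-i⟧ ≅ T := (shiftFunctorCompIsoId (DerivedCategory C) i (-i) (by simp)).app T
  let b := singleShiftIso (-i) i 0 (by simp) E
  refine ⟨a.inv ≫ f⟦-i⟧' ≫ b.hom, fun h0 => hf ?_⟩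
  apply (shiftFunctor (DerivedCategory C) (-i)).map_injective
  rw [← cancel_mono b.hom, ← cancel_epi a.inv]
  rw [h0]; simp

end Dir1

section Dir2
variable {C : Type u} [Category.{v} C] [Abelian C] [HasDerivedCategory.{w} C]
variable {D : Type u'} [Category.{v'} D] [Abelian D] [HasDerivedCategory.{t} D]
variable (F : DerivedCategory C ⥤ DerivedCategory D) 

def gSet (Y : DerivedCategory D) : Set ℤ :=
  {i | ∃ (E : C) (_ : Injective E) (f : Y ⟶ F.obj ((DerivedCategory.singleFunctor C i).obj E)), f ≠ 0}

lemma gSet_retract {X Y : DerivedCategory D} (s : Y ⟶ X) (r : X ⟶ Y) (h : s ≫ r = 𝟙 Y) :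
    gSet F Y ⊆ gSet F X := by
  rintro i ⟨E, hE, f, hf⟩
  refine ⟨E, hE, r ≫ f, fun h0 => hf ?_⟩
  rw [← id_comp f, ← h, assoc, h0, comp_zero]

lemma gSet_triClosed [F.CommShift ℤ] : TriClosed (fun X => (gSet F X).Finite) where
  iso := by
    intro X Y e h
    exact h.subset (gSet_retract F e.inv e.hom (by simp))
  shift := by
    intro X n h
    refine (h.image (fun i => i - n)).subset ?_
    rintro i ⟨E, hE, f, hf⟩
    refine ⟨i + n, ⟨E, hE, ?_⟩, by simp⟩
    let b : (X⟦n⟧)⟦-n⟧ ≅ X := (shiftFunctorCompIsoId (DerivedCategory D) n (-n) (by simp)).app X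
    let c : (F.obj ((DerivedCategory.singleFunctor C i).obj E))⟦-n⟧ ≅
        F.obj ((DerivedCategory.singleFunctor C (i+n)).obj E) :=
      ((F.commShiftIso (-n)).app _).symm ≪≫ F.mapIso (singleShiftIso (-n) (i+n) i (by lia) E)
    refine ⟨b.inv ≫ f⟦-n⟧' ≫ c.hom, fun h0 => hf ?_⟩
    apply (shiftFunctor (DerivedCategory D) (-n)).map_injective
    rw [← cancel_mono c.hom, ← cancel_epi b.inv]
    rw [h0]; simp
  ext₂ := by
    intro Δ hΔ h1 h3
    refine (h1.union h3).subset ?_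
    rintro i ⟨E, hE, f, hf⟩
    by_cases h : Δ.mor₁ ≫ f = 0
    · obtain ⟨g, hg⟩ := Triangle.yoneda_exact₂ Δ hΔ f h
      refine Or.inr ⟨E, hE, g, ?_⟩
      rintro rfl
      exact hf (hg.trans comp_zero)
    · exact Or.inl ⟨E, hE, _, h⟩

lemma gSet_obj [F.Full] [F.PreservesZeroMorphisms] (T : DerivedCategory C) : gSet F (F.obj T) ⊆ suppSet T := by
  rintro i ⟨E, hE, f, hf⟩
  obtain ⟨g, rfl⟩ := F.map_surjective f
  refine ⟨E, hE, g, ?_⟩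
  rintro rfl
  exact hf (F.map_zero _ _)

lemma mem_gSet [F.Faithful] [F.PreservesZeroMorphisms] (X : DerivedCategory C) :
    suppSet X ⊆ gSet F (F.obj X) := by
  rintro i ⟨E, hE, f, hf⟩
  refine ⟨E, hE, F.map f, fun h0 => hf (F.map_injective (h0.trans (F.map_zero _ _).symm))⟩

end Dir2

lemma gSet_projective {C : Type u} [Category.{v} C] [Abelian C] [HasDerivedCategory.{w} C]
    {R : Type w₂} [Ring R] [HasDerivedCategory.{t} (ModuleCat.{w₂} R)]
    (F : DerivedCategory C ⥤ DerivedCategory (ModuleCat.{w₂} R))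
    (h : (gSet F ((DerivedCategory.singleFunctor _ 0).obj (ModuleCat.of R R))).Finite)
    (M : ModuleCat.{w₂} R) (hM : Projective M) :
    (gSet F ((DerivedCategory.singleFunctor _ 0).obj M)).Finite := by
  obtain ⟨s, r, hsr⟩ := projective_retract M hM
  refine h.subset ((gSet_retract F (X := DerivedCategory.Q.obj _) (Y := DerivedCategory.Q.obj (sg 0 M))
    (DerivedCategory.Q.map s) (DerivedCategory.Q.map r) ?_).trans ?_)
  · rw [← Functor.map_comp, hsr]; exact DerivedCategory.Q.map_id _
  · rintro i ⟨E, hE, f, hf⟩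
    by_contra hcon
    refine hf (sum_hom_eq_zero f (fun j => ?_))
    by_contra h1
    exact hcon ⟨E, hE, _, h1⟩


theorem main
    (A : Type u) [Category.{v} A] [Abelian A] [HasColimits A] [HasFilteredColimits A]
    [AB5 A] [HasSeparator A] [HasDerivedCategory.{w} A]
    (T : DerivedCategory A) (hT : IsTilting.{t, w} T)
    [HasDerivedCategory.{w} (ModuleCat.{w} (End T)ᵐᵒᵖ)]
    (hA : ∃ d : ℕ, GlobalDimLE.{w} A d)
    (hL : ∃ d : ℕ, GlobalDimLE.{w} (ModuleCat.{w} (End T)ᵐᵒᵖ) d)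
    (F : DerivedCategory A ⥤ DerivedCategory (ModuleCat.{w} (End T)ᵐᵒᵖ))
    [F.CommShift ℤ] [F.IsTriangulated] [F.IsEquivalence]
    (e : F.obj T ≅ (DerivedCategory.singleFunctor (ModuleCat.{w} (End T)ᵐᵒᵖ) 0).obj
      (ModuleCat.of (End T)ᵐᵒᵖ ((End T)ᵐᵒᵖ))) :
    ∀ X : DerivedCategory A, IsBoundedObj X ↔ IsBoundedObj (F.obj X) := by
  have : IsGrothendieckAbelian.{v} A := {}
  have h4 : AB4OfSize.{v} A := inferInstance
  have h5 : HasExactColimitsOfShape (Discrete (ULift.{v} ℤ)) A := inferInstance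
  have hz : F.PreservesZeroMorphisms := inferInstance
  have hs : (suppSet T).Finite := suppSet_finite T hT.1
  obtain ⟨d, hd⟩ := hA
  obtain ⟨d', hd'⟩ := hL
  intro X
  constructor
  · intro hX
    have h := (homSet_triClosed T).of_bounded
      ((homSet_triClosed T).of_injectives d hd (homSet_injective T hs)) X hX
    refine (h.image (fun i => -i)).subset ?_
    intro i hi
    obtain ⟨f, hf⟩ := exists_from_ring_of_homology (F.obj X) i hi
    refine ⟨-i, ?_, by simp⟩
    let a : F.obj (T⟦-i⟧) ≅ (DerivedCategory.singleFunctor _ i).obj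
        (ModuleCat.of (End T)ᵐᵒᵖ ((End T)ᵐᵒᵖ)) :=
      (F.commShiftIso (-i)).app T ≪≫ (shiftFunctor _ (-i)).mapIso e ≪≫
        singleShiftIso (-i) i 0 (by simp) _
    obtain ⟨g, hg⟩ := F.map_surjective (a.hom ≫ f)
    refine ⟨g, ?_⟩
    rintro rfl
    apply hf
    rw [← cancel_epi a.hom, ← hg, comp_zero]
    exact F.map_zero _ _
  · intro hX
    have h0 : (gSet F ((DerivedCategory.singleFunctor (ModuleCat.{w} (End T)ᵐᵒᵖ) 0).obj
      (ModuleCat.of (End T)ᵐᵒᵖ ((End T)ᵐᵒᵖ)))).Finite :=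
      (gSet_triClosed F).iso e (hs.subset (gSet_obj F T))
    have h := (gSet_triClosed F).of_bounded
      ((gSet_triClosed F).of_projectives d' hd' (gSet_projective F h0)) (F.obj X) hX
    refine h.subset ?_
    intro i hi
    exact mem_gSet F X (mem_suppSet_of_homology X i hi)

end TiltAux

/-- **Lemma (preservation of boundedness).**
Let `A` be a Grothendieck abelian category and `T` a tilting object of `D(A)` with
endomorphism ring `Λ = End(T)`. Suppose that `A` and `Mod Λ` have finite global
dimension. Then the triangle equivalence `D(A) ≃ D(Mod Λ)` induced by `RHom(T, -)`
(i.e. any triangle equivalence identifying `T` with `Λ`) restricts to a triangle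
equivalence `D^b(A) ≃ D^b(Mod Λ)`: an object is bounded iff its image is bounded. -/
theorem isBoundedObj_iff_of_tilting_of_finite_gldim
    (A : Type u) [Category.{v} A] [Abelian A] [HasColimits A] [HasFilteredColimits A]
    [AB5 A] [HasSeparator A] [HasDerivedCategory.{w} A]
    (T : DerivedCategory A) (_ : IsTilting.{t, w} T)
    [HasDerivedCategory.{w} (ModuleCat.{w} (End T)ᵐᵒᵖ)]
    (_ : ∃ d : ℕ, GlobalDimLE.{w} A d)
    (_ : ∃ d : ℕ, GlobalDimLE.{w} (ModuleCat.{w} (End T)ᵐᵒᵖ) d)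
    (F : DerivedCategory A ⥤ DerivedCategory (ModuleCat.{w} (End T)ᵐᵒᵖ))
    [F.CommShift ℤ] [F.IsTriangulated] [F.IsEquivalence]
    (_ : F.obj T ≅ (DerivedCategory.singleFunctor (ModuleCat.{w} (End T)ᵐᵒᵖ) 0).obj
      (ModuleCat.of (End T)ᵐᵒᵖ ((End T)ᵐᵒᵖ))) :
    ∀ X : DerivedCategory A, IsBoundedObj X ↔ IsBoundedObj (F.obj X) := by
  exact TiltAux.main.{t} A T ‹_› ‹_› ‹_› F ‹_›
end

section
/- Let A be a Grothendieck abelian category of global dimension at most d, and T a tilting object of D(A) with endomorphism ring Λ = End(T), such that H^i T = 0 for all i outside the interval [-t, 0]. Identify D(A) with D(Mod Λ) via the triangle equivalence RHom(T,-), and let (D^{≤0}, D^{>0}) and (D(Λ)^{≤0}, D(Λ)^{>0}) denote the canonical t-structures of D(A) and D(Mod Λ) respectively. Then D(Λ)^{≥0} ⊆ D^{≥-d-t-2}. -/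
universe t w w₂ v u v' u'

open CategoryTheory Category Limits Pretriangulated Opposite

section Helpers

open DerivedCategory HomologicalComplex

variable {C : Type u} [Category.{v} C] [Abelian C]

lemma aux_exists_stupid (L : CochainComplex C ℤ) (a : ℤ) :
    ∃ (W : CochainComplex C ℤ) (_ : W.IsStrictlyGE a) (ι : W ⟶ L),
      ∀ i, a ≤ i → IsIso (ι.f i) := by
  let e := ComplexShape.embeddingUpIntGE a
  have he : ∀ i, a ≤ i → ∃ k, e.f k = i := fun i hi => by
    obtain ⟨k, rfl⟩ := Int.le.dest hi
    exact ⟨k, rfl⟩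
  have hn : ∀ i, ¬ a ≤ i → ∀ k, e.f k ≠ i := by
    intro i hi k hk
    apply hi
    rw [← hk]
    simp [e]
  choose k hk using he
  refine ⟨L.stupidTrunc e, ⟨(inferInstance : (L.stupidTrunc e).IsStrictlySupported e).isZero⟩,
    { f := fun i => if h : a ≤ i then (L.stupidTruncXIso e (hk i h)).hom else 0
      comm' := ?_ }, ?_⟩
  · rintro i j hij
    by_cases h : a ≤ i
    · have hij' : i + 1 = j := hij
      have h' : a ≤ j := by lia
      rw [dif_pos h, dif_pos h']
      have aux : ∀ (p q : ℕ) (hi : e.f p = i) (hj : e.f q = j),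
          (L.stupidTruncXIso e hi).hom ≫ L.d i j =
            (L.stupidTrunc e).d i j ≫ (L.stupidTruncXIso e hj).hom := by
        rintro p q rfl rfl
        simp [stupidTruncXIso, stupidTrunc, extend_d_eq _ e rfl rfl]
        erw [assoc, Iso.inv_hom_id_assoc, id_comp, comp_id]
      exact aux _ _ _ _
    · exact (L.isZero_stupidTrunc_X e i (hn i h)).eq_of_src _ _
  · intro i hi
    dsimp
    rw [dif_pos hi]
    infer_instance

lemma aux_lift {K W L : CochainComplex C ℤ} (a : ℤ) [K.IsStrictlyGE a] (ι : W ⟶ L)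
    (hι : ∀ i, a ≤ i → IsIso (ι.f i)) (g : K ⟶ L) : ∃ g' : K ⟶ W, g' ≫ ι = g := by
  refine ⟨{ f := fun i => if h : a ≤ i then g.f i ≫ (@inv _ _ _ _ (ι.f i) (hι i h)) else 0
            comm' := ?_ }, ?_⟩
  · rintro i j hij
    by_cases h : a ≤ i
    · have hij' : i + 1 = j := hij
      have h' : a ≤ j := by lia
      rw [dif_pos h, dif_pos h']
      have := hι i h
      have := hι j h'
      rw [← cancel_mono (ι.f j)]
      simp only [assoc, IsIso.inv_hom_id, comp_id]
      rw [← ι.comm, IsIso.inv_hom_id_assoc, g.comm]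
    · exact (K.isZero_of_isStrictlyGE a i (by lia)).eq_of_src _ _
  · ext i
    by_cases h : a ≤ i
    · have := hι i h
      simp [h]
    · exact (K.isZero_of_isStrictlyGE a i (by lia)).eq_of_src _ _

lemma aux_quasiIsoAt {W L : CochainComplex C ℤ} (a : ℤ) (ι : W ⟶ L)
    (hι : ∀ i, a ≤ i → IsIso (ι.f i)) (i : ℤ) (hi : a < i) : QuasiIsoAt ι i := by
  rw [quasiIsoAt_iff' ι (i - 1) i (i + 1) (by simp) (by simp)]
  have h1 := hι (i - 1) (by lia)
  have h2 := hι i (by lia)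
  have h3 := hι (i + 1) (by lia)
  have : IsIso ((shortComplexFunctor' C (.up ℤ) (i - 1) i (i + 1)).map ι).τ₁ := h1
  have : IsIso ((shortComplexFunctor' C (.up ℤ) (i - 1) i (i + 1)).map ι).τ₂ := h2
  have : IsIso ((shortComplexFunctor' C (.up ℤ) (i - 1) i (i + 1)).map ι).τ₃ := h3
  exact ShortComplex.quasiIso_of_epi_of_isIso_of_mono _

variable [HasDerivedCategory.{w} C]

/-- Any map from an object `≥ a` to an object `≤ a` factors through an object in `[a, a]`. -/
lemma aux_factor {T Y : DerivedCategory C} (a : ℤ) [T.IsGE a] [Y.IsLE a] (f : T ⟶ Y) :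
    ∃ (W : DerivedCategory C) (_ : W.IsGE a) (_ : W.IsLE a) (g : T ⟶ W) (h : W ⟶ Y),
      f = g ≫ h := by
  obtain ⟨K, _, ⟨e⟩⟩ := T.exists_iso_Q_obj_of_isGE a
  obtain ⟨L, _, ⟨e'⟩⟩ := Y.exists_iso_Q_obj_of_isLE a
  obtain ⟨L', g, s, hs, hf⟩ := left_fac (e.inv ≫ f ≫ e'.hom)
  obtain ⟨W, _, ι, hι⟩ := aux_exists_stupid L' a
  obtain ⟨g', rfl⟩ := aux_lift a ι hι g
  have hL' : L'.IsLE a := by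
    rw [← isLE_Q_obj_iff]
    exact TStructure.t.isLE_of_iso (asIso (Q.map s)) a
  have hW : W.IsLE a := by
    rw [CochainComplex.isLE_iff]
    intro i hi
    have := aux_quasiIsoAt a ι hι i hi
    rw [exactAt_iff_of_quasiIsoAt ι i]
    exact L'.exactAt_of_isLE a i hi
  refine ⟨Q.obj W, inferInstance, inferInstance, e.hom ≫ Q.map g',
    Q.map ι ≫ inv (Q.map s) ≫ e'.inv, ?_⟩
  rw [Functor.map_comp, assoc] at hf
  have : f = e.hom ≫ (e.inv ≫ f ≫ e'.hom) ≫ e'.inv := by simp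
  rw [this, hf]
  simp

lemma aux_single {d : ℕ} (hd : GlobalDimLE.{w} C d) {T Y : DerivedCategory C} (p q : ℤ)
    [T.IsGE p] [T.IsLE p] [Y.IsGE q] [Y.IsLE q] (h : q < p - d) (f : T ⟶ Y) : f = 0 := by
  have := TStructure.t.isGE_shift T p p 0
  have := TStructure.t.isLE_shift T p p 0
  have := TStructure.t.isGE_shift Y q q 0
  have := TStructure.t.isLE_shift Y q q 0
  obtain ⟨A, ⟨eA⟩⟩ := (T⟦p⟧).exists_iso_singleFunctor_obj_of_isGE_of_isLE 0
  obtain ⟨B, ⟨eB⟩⟩ := (Y⟦q⟧).exists_iso_singleFunctor_obj_of_isGE_of_isLE 0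
  let eY : Y⟦p⟧ ≅ ((singleFunctor C 0).obj B)⟦p - q⟧ :=
    (shiftFunctorAdd' (DerivedCategory C) q (p - q) p (by lia)).app Y ≪≫
      (shiftFunctor (DerivedCategory C) (p - q)).mapIso eB
  apply (shiftFunctor (DerivedCategory C) p).map_injective
  rw [Functor.map_zero, ← cancel_epi eA.inv, ← cancel_mono eY.hom]
  exact (hd A B (p - q) (by lia)).elim _ _

lemma aux_bounded {d : ℕ} (hd : GlobalDimLE.{w} C d) (q : ℤ) {Y : DerivedCategory C}
    [Y.IsGE q] [Y.IsLE q] (k : ℕ) : ∀ (T : DerivedCategory C) (p : ℤ) [T.IsGE p] [T.IsLE (p + k)]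
    (_ : q < p - d) (f : T ⟶ Y), f = 0 := by
  induction k with
  | zero =>
    intro T p _ hT h f
    simp only [Nat.cast_zero, add_zero] at hT
    exact aux_single hd p q h f
  | succ k ih =>
    intro T p _ hT h f
    have hdist := TStructure.t.triangleLTGE_distinguished (p + 1) T
    obtain ⟨g, hg⟩ := Triangle.yoneda_exact₂ _ hdist f (by
      have : (((TStructure.t.triangleLTGE (p + 1)).obj T).obj₁).IsGE p :=
        inferInstanceAs (TStructure.t.IsGE ((TStructure.t.truncLT (p+1)).obj T) p)
      have : (((TStructure.t.triangleLTGE (p + 1)).obj T).obj₁).IsLE p :=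
        inferInstanceAs (TStructure.t.IsLE ((TStructure.t.truncLT (p+1)).obj T) p)
      exact aux_single hd p q h _)
    rw [hg]
    have h3 : (((TStructure.t.triangleLTGE (p + 1)).obj T).obj₃).IsGE (p + 1) :=
      inferInstanceAs (TStructure.t.IsGE ((TStructure.t.truncGE (p+1)).obj T) (p + 1))
    have h4 : (((TStructure.t.triangleLTGE (p + 1)).obj T).obj₃).IsLE (p + 1 + k) := by
      have : p + 1 + (k : ℤ) = p + (k + 1 : ℕ) := by push_cast; ring
      rw [this]
      exact inferInstanceAs (TStructure.t.IsLE ((TStructure.t.truncGE (p+1)).obj T) (p + (k+1 : ℕ)))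
    rw [ih _ (p + 1) (by lia) g]
    exact comp_zero

lemma aux_hom_zero {d : ℕ} (hd : GlobalDimLE.{w} C d) {T Y : DerivedCategory C} (t : ℕ) (a : ℤ)
    [hT : T.IsGE (-t)] [T.IsLE 0] [Y.IsLE a] (h : a < - t - d) (f : T ⟶ Y) : f = 0 := by
  have : T.IsGE a := TStructure.t.isGE_of_ge T a (-t)
  obtain ⟨W, _, _, g, h, rfl⟩ := aux_factor a f
  have : T.IsLE (-t + t) := by simpa
  rw [aux_bounded hd a t T (-t) (by lia) g, zero_comp]

lemma aux_complex {R : Type w} [Ring R] (N : CochainComplex (ModuleCat.{w} R) ℤ)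
    [HasDerivedCategory.{w} (ModuleCat.{w} R)]
    (h : ∀ f : (singleFunctor (ModuleCat.{w} R) 0).obj (ModuleCat.of R R) ⟶ Q.obj N, f = 0) :
    IsZero (N.homology 0) := by
  have key : ∀ v : ModuleCat.of R R ⟶ N.homology 0, v = 0 := by
    intro v
    have : Projective (ModuleCat.of R R) := inferInstance
    let u : ModuleCat.of R R ⟶ N.cycles 0 := Projective.factorThru v (N.homologyπ 0)
    have hu : u ≫ N.homologyπ 0 = v := Projective.factorThru_comp _ _
    let φ : (single (ModuleCat.{w} R) (.up ℤ) 0).obj (ModuleCat.of R R) ⟶ N :=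
      mkHomFromSingle (u ≫ N.iCycles 0) (by simp)
    have hφ : Q.map φ = 0 := h _
    have h0 : homologyMap φ 0 = 0 := by
      have := homologyFunctorFactors_hom_naturality φ 0
      rw [hφ, Functor.map_zero, zero_comp] at this
      refine (cancel_epi ((homologyFunctorFactors _ 0).hom.app _)).1 (this.symm.trans ?_)
      exact comp_zero.symm
    have h1 : cyclesMap φ 0 = (singleObjCyclesSelfIso (.up ℤ) 0 _).hom ≫ u := by
      rw [← cancel_mono (N.iCycles 0)]
      simp [φ, singleObjCyclesSelfIso_hom]
    have h2 := homologyπ_naturality φ 0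
    rw [h0, comp_zero, h1, assoc, hu] at h2
    rw [← cancel_epi (singleObjCyclesSelfIso (.up ℤ) 0 (ModuleCat.of R R)).hom, ← h2, comp_zero]
  rw [ModuleCat.isZero_iff_subsingleton]
  refine ⟨fun x y => ?_⟩
  have hx : ∀ x : N.homology 0, x = 0 := fun x => by
    have := key (ModuleCat.ofHom (LinearMap.toSpanSingleton R _ x))
    have := congr($(this).hom (1 : R))
    exact (LinearMap.toSpanSingleton_apply_one R _ x).symm.trans this
  rw [hx x, hx y]

lemma aux_module {R : Type w} [Ring R]
    [HasDerivedCategory.{w} (ModuleCat.{w} R)] (M : DerivedCategory (ModuleCat.{w} R)) (i : ℤ)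
    (h : ∀ f : (singleFunctor (ModuleCat.{w} R) 0).obj (ModuleCat.of R R) ⟶ M⟦i⟧, f = 0) :
    IsZero ((homologyFunctor _ i).obj M) := by
  obtain ⟨N, ⟨e⟩⟩ : ∃ N, Nonempty (Q.obj N ≅ M⟦i⟧) := ⟨_, ⟨Q.objObjPreimageIso _⟩⟩
  have h0 : IsZero (N.homology 0) := aux_complex N (fun f => by
    rw [← cancel_mono e.hom, h (f ≫ e.hom), zero_comp])
  have e1 : (homologyFunctor _ 0).obj (M⟦i⟧) ≅ (homologyFunctor _ i).obj M :=
    ((homologyFunctor (ModuleCat.{w} R) 0).shiftIso i 0 i (by lia)).app M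
  exact h0.of_iso (e1.symm ≪≫ (homologyFunctor _ 0).mapIso e.symm ≪≫
    (homologyFunctorFactors _ 0).app N)

end Helpers

/-- **Lemma (comparison of t-structures, II).**
Let `A` be a Grothendieck abelian category of global dimension at most `d` and `T` a
tilting object of `D(A)` with `Λ = End(T)` such that `H^i T = 0` for `i ∉ [-t, 0]`.
Identify `D(A)` with `D(Mod Λ)` via the triangle equivalence induced by `RHom(T, -)`
(i.e. any triangle equivalence `F` identifying `T` with `Λ`). Then
`D(Λ)^{≥0} ⊆ D^{≥ -d-t-2}`: if `H^i (F X) = 0` for all `i < 0`, then `H^i X = 0`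
for all `i < -d - t - 2`. -/
theorem tStructureGE_subset_of_tilting
    (A : Type u) [Category.{v} A] [Abelian A] [HasColimits A] [HasFilteredColimits A]
    [AB5 A] [HasSeparator A] [HasDerivedCategory.{w} A]
    (d : ℕ) (_ : GlobalDimLE.{w} A d)
    (T : DerivedCategory A) (_ : IsTilting.{t, w} T)
    (tlen : ℕ)
    (_ : ∀ i : ℤ, i ∉ Set.Icc (-(tlen : ℤ)) 0 →
      IsZero ((DerivedCategory.homologyFunctor A i).obj T))
    [HasDerivedCategory.{w} (ModuleCat.{w} (End T)ᵐᵒᵖ)]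
    (F : DerivedCategory A ⥤ DerivedCategory (ModuleCat.{w} (End T)ᵐᵒᵖ))
    [F.CommShift ℤ] [F.IsTriangulated] [F.IsEquivalence]
    (_ : F.obj T ≅ (DerivedCategory.singleFunctor (ModuleCat.{w} (End T)ᵐᵒᵖ) 0).obj
      (ModuleCat.of (End T)ᵐᵒᵖ ((End T)ᵐᵒᵖ)))
    (X : DerivedCategory A)
    (hX : ∀ i : ℤ, i < 0 → IsZero ((DerivedCategory.homologyFunctor
      (ModuleCat.{w} (End T)ᵐᵒᵖ) i).obj (F.obj X))) :
    ∀ i : ℤ, i < -(d : ℤ) - tlen - 2 → IsZero ((DerivedCategory.homologyFunctor A i).obj X) := by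
  rename_i hd hT hTlen _ _ _ _ e
  have : T.IsGE (-(tlen : ℤ)) := by
    rw [DerivedCategory.isGE_iff]
    exact fun i hi => hTlen i (fun h => by have := h.1; lia)
  have : T.IsLE 0 := by
    rw [DerivedCategory.isLE_iff]
    exact fun i hi => hTlen i (fun h => by have := h.2; lia)
  have : (F.obj X).IsGE 0 := by
    rw [DerivedCategory.isGE_iff]
    exact hX
  set n : ℤ := -(d : ℤ) - tlen - 2 with hn
  have key : ∀ (Y : DerivedCategory A) [Y.IsLE (n - 1)] (f : Y ⟶ X), f = 0 := by
    intro Y _ f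
    have : (F.obj Y).IsLE (-1) := by
      rw [DerivedCategory.isLE_iff]
      intro i hi
      apply aux_module
      intro g
      have : (Y⟦i⟧).IsLE (n - 1 - i) := DerivedCategory.TStructure.t.isLE_shift Y (n - 1) i _
      obtain ⟨g', hg'⟩ := F.map_surjective (e.hom ≫ g ≫ (F.commShiftIso i).inv.app Y)
      rw [aux_hom_zero hd tlen (n - 1 - i) (by lia) g', F.map_zero] at hg'
      rw [← cancel_epi e.hom, ← cancel_mono ((F.commShiftIso i).inv.app Y), assoc, ← hg']
      simp
    apply F.map_injective
    rw [F.map_zero]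
    exact DerivedCategory.TStructure.t.zero (F.map f) (-1) 0
  have hdist := DerivedCategory.TStructure.t.triangleLTGE_distinguished n X
  obtain ⟨r, hr⟩ := Triangle.yoneda_exact₂ _ hdist (𝟙 X) (by
    have : (((DerivedCategory.TStructure.t.triangleLTGE n).obj X).obj₁).IsLE (n - 1) := 
      inferInstanceAs (DerivedCategory.TStructure.t.IsLE _ (n - 1))
    exact key _ _)
  intro i hi
  have h3 : (((DerivedCategory.TStructure.t.triangleLTGE n).obj X).obj₃).IsGE n :=
    inferInstanceAs (DerivedCategory.TStructure.t.IsGE _ n)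
  have hz := DerivedCategory.isZero_of_isGE _ n i hi (hX := h3)
  rw [IsZero.iff_id_eq_zero]
  have h5 := congr((DerivedCategory.homologyFunctor A i).map $hr)
  rw [Functor.map_comp, hz.eq_of_src ((DerivedCategory.homologyFunctor A i).map r) 0,
    comp_zero] at h5
  exact ((DerivedCategory.homologyFunctor A i).map_id X).symm.trans h5
end
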